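/- arXiv:2010.08747 — 2 statements merged into one kernel-verified Lean document; each statement's English description precedes it below -/
import Mathlib

section
/- Let s ∈ ℝ and λ ∈ (4/3, 3/2). There exists a constant C > 0, independent of n, such that for all n ≥ 1 the function u_{0,n}(x) = 2^{-ns} φ(x) sin(λ2^n x) satisfies both ∫_ℝ |ξ| |û_{0,n}(ξ)| dξ ≤ C 2^{-n(s-1)} and ∫_ℝ (1+ξ²)^{1/2} |û_{0,n}(ξ)| dξ ≤ C 2^{-n(s-1)}. -/
open MeasureTheory Filter Complex

noncomputable section

/-- Fourier transform with convention `f̂(ξ) = ∫ e^{-ixξ} f(x) dx`. -/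
def FT (f : ℝ → ℂ) (ξ : ℝ) : ℂ :=
  ∫ x : ℝ, Complex.exp (-(Complex.I * (x : ℂ) * (ξ : ℂ))) * f x

/-- Sobolev `H^σ` norm: `‖f‖_{H^σ}² = ∫ (1+ξ²)^σ |f̂(ξ)|² dξ`. -/
def HNorm (σ : ℝ) (f : ℝ → ℂ) : ℝ :=
  Real.sqrt (∫ ξ : ℝ, (1 + ξ ^ 2) ^ σ * ‖FT f ξ‖ ^ 2)

/-- Membership in `H^σ` (finiteness of the `H^σ` norm). -/
def MemHs (σ : ℝ) (f : ℝ → ℂ) : Prop :=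
  MeasureTheory.Integrable (fun ξ : ℝ => (1 + ξ ^ 2) ^ σ * ‖FT f ξ‖ ^ 2)

/-- `L²` norm. -/
def L2Norm (f : ℝ → ℂ) : ℝ :=
  Real.sqrt (∫ x : ℝ, ‖f x‖ ^ 2)

/-- Fourier multiplier operator with symbol `m`. -/
def FMul (m : ℝ → ℂ) (f : ℝ → ℂ) (x : ℝ) : ℂ :=
  (1 / (2 * (Real.pi : ℂ))) * ∫ ξ : ℝ, Complex.exp (Complex.I * (x : ℂ) * (ξ : ℂ)) * m ξ * FT f ξ

/-- `Λ = (1-∂ₓ²)^{1/2}`: Fourier multiplier with symbol `(1+ξ²)^{1/2}`. -/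
def Lam (f : ℝ → ℂ) : ℝ → ℂ :=
  FMul (fun ξ => ((Real.sqrt (1 + ξ ^ 2) : ℝ) : ℂ)) f

/-- `e^{-t ∂ₓ Λ^{-1}}`: Fourier multiplier with symbol `e^{-itξ(1+ξ²)^{-1/2}}`. -/
def ExpOp (t : ℝ) (f : ℝ → ℂ) : ℝ → ℂ :=
  FMul (fun ξ => Complex.exp (-(Complex.I * (t : ℂ) * (ξ : ℂ) / ((Real.sqrt (1 + ξ ^ 2) : ℝ) : ℂ)))) f

/-- Hypotheses on the fixed Schwartz function `φ`: its Fourier transform is a smooth, even,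
real-valued function with values in `[0,1]`, equal to `1` on `[-1/4,1/4]` and to `0`
outside `(-1/2,1/2)`. -/
def PhiHyp (φ : ℝ → ℂ) : Prop :=
  ∃ ψ : ℝ → ℝ, (∀ ξ : ℝ, FT φ ξ = (ψ ξ : ℂ)) ∧ ContDiff ℝ (⊤ : ℕ∞) ψ ∧
    (∀ ξ : ℝ, ψ (-ξ) = ψ ξ) ∧ (∀ ξ : ℝ, ψ ξ ∈ Set.Icc (0 : ℝ) 1) ∧
    (∀ ξ : ℝ, |ξ| ≤ 1 / 4 → ψ ξ = 1) ∧ (∀ ξ : ℝ, 1 / 2 ≤ |ξ| → ψ ξ = 0)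

/-- The high-frequency data `u_{0,n}(x) = 2^{-ns} φ(x) sin(λ 2ⁿ x)`. -/
def u0n (s lam : ℝ) (φ : ℝ → ℂ) (n : ℕ) : ℝ → ℂ :=
  fun x => (((2 : ℝ) ^ (-((n : ℝ) * s)) : ℝ) : ℂ) * φ x * ((Real.sin (lam * 2 ^ n * x) : ℝ) : ℂ)

/-- The low-frequency data `f_n(x) = 2^{-n} φ(x)`. -/
def fseq (φ : ℝ → ℂ) (n : ℕ) : ℝ → ℂ :=
  fun x => (((2 : ℝ) ^ (-(n : ℝ)) : ℝ) : ℂ) * φ x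

/-- The kernel `K(x) = -(1/2) sgn(x) e^{-|x|}`, so that `K*f = ∂ₓ(1-∂ₓ²)^{-1} f`. -/
def Kker (x : ℝ) : ℝ := -(1 / 2) * Real.sign x * Real.exp (-|x|)

/-- Convolution with the kernel `K`. -/
def Kconv (f : ℝ → ℂ) (x : ℝ) : ℂ := ∫ y : ℝ, ((Kker (x - y) : ℝ) : ℂ) * f y

/-- `(u,ϱ)` solves the two-component Camassa–Holm system (in nonlocal form) on `[0,T]`. -/
def Is2CHSolution (T : ℝ) (u ϱ : ℝ → ℝ → ℂ) : Prop :=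
  ∀ t ∈ Set.Icc (0 : ℝ) T, ∀ x : ℝ,
    (deriv (fun τ => u τ x) t + Kconv (ϱ t) x + u t x * deriv (u t) x
      = - Kconv (fun y => (u t y) ^ 2 + (1 / 2 : ℂ) * (deriv (u t) y) ^ 2
          + (1 / 2 : ℂ) * (ϱ t y) ^ 2) x)
    ∧ (deriv (fun τ => ϱ τ x) t + deriv (u t) x + u t x * deriv (ϱ t) x
        + ϱ t x * deriv (u t) x = 0)

/-- `u ∈ C([0,T]; H^γ)`: each time slice is in `H^γ` and `t ↦ u(t)` is continuous
in the `H^γ` norm. -/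
def ContInHs (T γ : ℝ) (u : ℝ → ℝ → ℂ) : Prop :=
  (∀ t ∈ Set.Icc (0 : ℝ) T, MemHs γ (u t)) ∧
  ∀ t₀ ∈ Set.Icc (0 : ℝ) T,
    Filter.Tendsto (fun t => HNorm γ (fun x => u t x - u t₀ x))
      (nhdsWithin t₀ (Set.Icc (0 : ℝ) T)) (nhds 0)

end

theorem integrable_exp_neg_mul_schwartz (φ : SchwartzMap ℝ ℂ) (ξ : ℝ) :
    Integrable (fun x : ℝ => Complex.exp (-(Complex.I * (x : ℂ) * (ξ : ℂ))) * φ x) := by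
  refine φ.integrable.bdd_mul (c := 1) (by fun_prop) (Eventually.of_forall fun x => ?_)
  rw [Complex.norm_exp]
  simp

/-- Multiplication by `sin (ω x)` splits the spectrum into two translates. -/
theorem FT_const_mul_sin (φ : SchwartzMap ℝ ℂ) (c : ℂ) (ω ξ : ℝ) :
    FT (fun x => c * φ x * ((Real.sin (ω * x) : ℝ) : ℂ)) ξ
      = c * (Complex.I / 2) * (FT φ (ξ + ω) - FT φ (ξ - ω)) := by
  unfold FT
  rw [← integral_sub (integrable_exp_neg_mul_schwartz φ _) (integrable_exp_neg_mul_schwartz φ _),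
    ← integral_const_mul]
  refine integral_congr_ae (Eventually.of_forall fun x => ?_)
  have h₁ : Complex.exp (-(Complex.I * (x : ℂ) * ((ξ + ω : ℝ) : ℂ)))
      = Complex.exp (-(Complex.I * (x : ℂ) * (ξ : ℂ))) * Complex.exp (-(ω * x) * Complex.I) := by
    rw [← Complex.exp_add]; congr 1; push_cast; ring
  have h₂ : Complex.exp (-(Complex.I * (x : ℂ) * ((ξ - ω : ℝ) : ℂ)))
      = Complex.exp (-(Complex.I * (x : ℂ) * (ξ : ℂ))) * Complex.exp (ω * x * Complex.I) := by
    rw [← Complex.exp_add]; congr 1; push_cast; ring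
  simp only [h₁, h₂, Complex.ofReal_sin, Complex.ofReal_mul, Complex.sin]
  ring

/-- A weight of linear growth integrates the modulus of the Fourier transform of
`c φ(x) sin (ω x)` to at most a multiple of `1 + ω`. -/
theorem integral_weight_mul_norm_FT_sin_le (φ : SchwartzMap ℝ ℂ) (hφ : PhiHyp ⇑φ) {w : ℝ → ℝ}
    (hw₀ : ∀ ξ, 0 ≤ w ξ) (hw : ∀ ξ, w ξ ≤ 1 + |ξ|) {c ω : ℝ} (hc : 0 ≤ c) (hω : 0 ≤ ω) :
    (∫ ξ : ℝ, w ξ * ‖FT (fun x => (c : ℂ) * φ x * ((Real.sin (ω * x) : ℝ) : ℂ)) ξ‖)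
      ≤ c * (3 / 2 + ω) := by
  obtain ⟨ψ, hψ, -, -, hI, -, hsupp⟩ := hφ
  set χ : ℝ → ℝ := (Set.Icc (-(1 / 2) : ℝ) (1 / 2)).indicator 1 with hχ
  have hχint : Integrable χ :=
    (integrable_indicator_iff measurableSet_Icc).2 (integrableOn_const (by simp))
  have hχval : ∫ ξ, χ ξ = 1 := by
    rw [hχ, integral_indicator_one measurableSet_Icc]
    norm_num
  have key : ∀ ξ η : ℝ, |ξ| ≤ ω + |η| → w ξ * ψ η ≤ (3 / 2 + ω) * χ η := by
    intro ξ η h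
    by_cases hη : 1 / 2 ≤ |η|
    · rw [hsupp η hη, mul_zero]
      exact mul_nonneg (by linarith) (Set.indicator_nonneg (fun _ _ => zero_le_one) _)
    · have hη' := not_le.1 hη
      have hmem : χ η = 1 := Set.indicator_of_mem (Set.mem_Icc.2 (abs_le.1 hη'.le)) _
      rw [hmem]
      exact mul_le_mul (by linarith [hw ξ]) (hI η).2 (hI η).1 (by linarith)
  have hg : Integrable fun ξ => c / 2 * (3 / 2 + ω) * (χ (ξ + ω) + χ (ξ - ω)) :=
    ((hχint.comp_add_right ω).add (hχint.comp_sub_right ω)).const_mul _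
  calc _ ≤ ∫ ξ, c / 2 * (3 / 2 + ω) * (χ (ξ + ω) + χ (ξ - ω)) := by
        refine integral_mono_of_nonneg
          (Eventually.of_forall fun ξ => mul_nonneg (hw₀ ξ) (norm_nonneg _)) hg
          (Eventually.of_forall fun ξ => ?_)
        have hnorm : ‖FT φ (ξ + ω) - FT φ (ξ - ω)‖ ≤ ψ (ξ + ω) + ψ (ξ - ω) := by
          refine (norm_sub_le _ _).trans_eq ?_
          rw [hψ, hψ, Complex.norm_of_nonneg (hI _).1, Complex.norm_of_nonneg (hI _).1]
        have h₁ := key ξ (ξ + ω) (by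
          have := abs_sub (ξ + ω) ω
          rw [add_sub_cancel_right, abs_of_nonneg hω] at this
          linarith)
        have h₂ := key ξ (ξ - ω) (by
          have := abs_add_le (ξ - ω) ω
          rw [sub_add_cancel, abs_of_nonneg hω] at this
          linarith)
        have hc2 : 0 ≤ c / 2 := by linarith
        simp only [FT_const_mul_sin, norm_mul, norm_div, Complex.norm_I, Complex.norm_ofNat,
          Complex.norm_of_nonneg hc]
        calc _ = c / 2 * (w ξ * ‖FT φ (ξ + ω) - FT φ (ξ - ω)‖) := by ring
          _ ≤ c / 2 * (w ξ * (ψ (ξ + ω) + ψ (ξ - ω))) :=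
            mul_le_mul_of_nonneg_left (mul_le_mul_of_nonneg_left hnorm (hw₀ ξ)) hc2
          _ ≤ c / 2 * ((3 / 2 + ω) * (χ (ξ + ω) + χ (ξ - ω))) :=
            mul_le_mul_of_nonneg_left (by linarith) hc2
          _ = _ := by ring
    _ = c * (3 / 2 + ω) := by
        rw [integral_const_mul, integral_add (hχint.comp_add_right ω) (hχint.comp_sub_right ω),
          integral_add_right_eq_self, integral_sub_right_eq_self, hχval]
        ring

/-- `‖∂ₓu_{0,n}^‖_{L¹} + ‖(Λu_{0,n})^‖_{L¹} ≤ C 2^{-n(s-1)}` in the form of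
weighted `L¹` bounds on `û_{0,n}`. -/
theorem stmt3 (s lam : ℝ) (hlam : lam ∈ Set.Ioo (4 / 3 : ℝ) (3 / 2))
    (φ : SchwartzMap ℝ ℂ) (hφ : PhiHyp ⇑φ) :
    ∃ C > (0 : ℝ), ∀ n : ℕ, 1 ≤ n →
      (∫ ξ : ℝ, |ξ| * ‖FT (u0n s lam ⇑φ n) ξ‖) ≤ C * (2 : ℝ) ^ (-((n : ℝ) * (s - 1))) ∧
      (∫ ξ : ℝ, Real.sqrt (1 + ξ ^ 2) * ‖FT (u0n s lam ⇑φ n) ξ‖)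
        ≤ C * (2 : ℝ) ^ (-((n : ℝ) * (s - 1))) := by
  have bound : ∀ w : ℝ → ℝ, (∀ ξ, 0 ≤ w ξ) → (∀ ξ, w ξ ≤ 1 + |ξ|) → ∀ n : ℕ,
      (∫ ξ : ℝ, w ξ * ‖FT (u0n s lam ⇑φ n) ξ‖) ≤ 3 * (2 : ℝ) ^ (-((n : ℝ) * (s - 1))) := by
    intro w hw₀ hw n
    have hlam₀ : 0 ≤ lam := by linarith [hlam.1]
    have hpow : (1 : ℝ) ≤ 2 ^ n := one_le_pow₀ one_le_two
    refine (integral_weight_mul_norm_FT_sin_le φ hφ hw₀ hw (c := (2 : ℝ) ^ (-((n : ℝ) * s)))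
      (ω := lam * 2 ^ n) (by positivity) (by positivity)).trans ?_
    have hsplit : (2 : ℝ) ^ (-((n : ℝ) * (s - 1))) = (2 : ℝ) ^ (-((n : ℝ) * s)) * 2 ^ n := by
      rw [← Real.rpow_natCast, ← Real.rpow_add two_pos]
      ring_nf
    rw [hsplit, mul_left_comm]
    gcongr
    nlinarith [hlam.2]
  refine ⟨3, by norm_num, fun n _ => ⟨bound _ (fun ξ => abs_nonneg ξ) (fun ξ => by linarith) n,
    bound _ (fun ξ => Real.sqrt_nonneg _) (fun ξ => ?_) n⟩⟩
  rw [Real.sqrt_le_left (by positivity)]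
  nlinarith [abs_nonneg ξ, sq_abs ξ]
end

section
/- Let s > 3/2 and λ ∈ (4/3, 3/2). There exists a constant C̃₁ > 0 such that liminf_{n→∞} ‖f_n ∂_x u_{0,n}‖_{H^s} ≥ C̃₁, where u_{0,n}(x) = 2^{-ns} φ(x) sin(λ2^n x) and f_n(x) = 2^{-n} φ(x). -/
open MeasureTheory Filter Complex

open scoped FourierTransform SchwartzMap in
theorem FT_eq_fourier (f : ℝ → ℂ) (ξ : ℝ) : FT f ξ = 𝓕 f (ξ / (2 * Real.pi)) := by
  rw [Real.fourier_real_eq_integral_exp_smul, FT]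
  congr 1 with x
  rw [smul_eq_mul]
  congr 2
  push_cast
  have : (Real.pi : ℂ) ≠ 0 := by exact_mod_cast Real.pi_ne_zero
  field_simp

open scoped FourierTransform SchwartzMap in
/-- The Fourier transform `FT` of a Schwartz function is a Schwartz function. -/
theorem exists_schwartz_FT (B : 𝓢(ℝ, ℂ)) (hB : B ≠ 0) :
    ∃ h : 𝓢(ℝ, ℂ), (∀ ξ, FT B ξ = h ξ) ∧ (∀ ξ, FT (deriv B) ξ = I * ξ * h ξ) ∧
      ∃ η, h η ≠ 0 := by
  have hpi : (2 * Real.pi)⁻¹ ≠ 0 := by positivity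
  let g : ℝ ≃L[ℝ] ℝ := ContinuousLinearEquiv.unitsEquivAut ℝ (Units.mk0 _ hpi)
  have hg : ∀ ξ, g ξ = ξ / (2 * Real.pi) := fun ξ => by
    simp [g, div_eq_mul_inv]
  have hh : ∀ ξ, FT B ξ = SchwartzMap.compCLMOfContinuousLinearEquiv ℂ g (𝓕 B) ξ := fun ξ => by
    rw [FT_eq_fourier, ← hg]
    simp [SchwartzMap.fourier_coe]
  refine ⟨SchwartzMap.compCLMOfContinuousLinearEquiv ℂ g (𝓕 B), hh, fun ξ => ?_, ?_⟩
  · rw [← hh, FT_eq_fourier, FT_eq_fourier, Real.fourier_deriv B.integrable B.differentiable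
      (SchwartzMap.derivCLM ℂ ℂ B).integrable]
    simp only [smul_eq_mul]
    push_cast
    have : (Real.pi : ℂ) ≠ 0 := by exact_mod_cast Real.pi_ne_zero
    field_simp
  · by_contra! H
    apply hB
    have : 𝓕 B = 0 := by
      ext x
      have := H (g.symm x)
      simpa using this
    have hinv : 𝓕⁻ (𝓕 B) = B := FourierTransform.fourierInv_fourier_eq B
    rw [← hinv, this, FourierTransform.fourierInv_zero]

theorem integrable_exp_mul {f : ℝ → ℂ} (hf : Integrable f) (ξ : ℝ) :
    Integrable (fun x : ℝ => Complex.exp (-(Complex.I * (x : ℂ) * (ξ : ℂ))) * f x) := by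
  refine hf.bdd_mul (c := 1) (by fun_prop) (Eventually.of_forall fun x => ?_)
  rw [Complex.norm_exp]
  simp

theorem FT_mul_sin {f : ℝ → ℂ} (hf : Integrable f) (N ξ : ℝ) :
    FT (fun x => f x * ((Real.sin (N * x) : ℝ) : ℂ)) ξ =
      (FT f (ξ - N) - FT f (ξ + N)) / (2 * I) := by
  unfold FT
  rw [← integral_sub (integrable_exp_mul hf _) (integrable_exp_mul hf _), ← integral_div]
  congr 1 with x
  have h1 : Complex.exp (-(I * x * ((ξ - N : ℝ) : ℂ))) =
      Complex.exp (-(I * x * ξ)) * Complex.exp (N * x * I) := by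
    rw [← Complex.exp_add]; congr 1; push_cast; ring
  have h2 : Complex.exp (-(I * x * ((ξ + N : ℝ) : ℂ))) =
      Complex.exp (-(I * x * ξ)) * Complex.exp (-(N * x) * I) := by
    rw [← Complex.exp_add]; congr 1; push_cast; ring
  simp only [h1, h2, Complex.ofReal_sin, Complex.sin]
  push_cast
  field_simp
  rw [Complex.I_sq]
  ring

theorem FT_mul_cos {f : ℝ → ℂ} (hf : Integrable f) (N ξ : ℝ) :
    FT (fun x => f x * ((Real.cos (N * x) : ℝ) : ℂ)) ξ =
      (FT f (ξ - N) + FT f (ξ + N)) / 2 := by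
  unfold FT
  rw [← integral_add (integrable_exp_mul hf _) (integrable_exp_mul hf _), ← integral_div]
  congr 1 with x
  have h1 : Complex.exp (-(I * x * ((ξ - N : ℝ) : ℂ))) =
      Complex.exp (-(I * x * ξ)) * Complex.exp (N * x * I) := by
    rw [← Complex.exp_add]; congr 1; push_cast; ring
  have h2 : Complex.exp (-(I * x * ((ξ + N : ℝ) : ℂ))) =
      Complex.exp (-(I * x * ξ)) * Complex.exp (-(N * x) * I) := by
    rw [← Complex.exp_add]; congr 1; push_cast; ring
  simp only [h1, h2, Complex.ofReal_cos, Complex.cos]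
  push_cast
  ring

theorem fseq_mul_deriv_u0n (s lam : ℝ) (φ : SchwartzMap ℝ ℂ) (n : ℕ) (x : ℝ) :
    fseq φ n x * deriv (u0n s lam φ n) x =
      (((2 : ℝ) ^ (-((n : ℝ) * s)) * (2 : ℝ) ^ (-(n : ℝ)) : ℝ) : ℂ) *
        (deriv (fun y => φ y * φ y) x / 2 * ((Real.sin (lam * 2 ^ n * x) : ℝ) : ℂ) +
          ((lam * 2 ^ n : ℝ) : ℂ) *
            (φ x * φ x * ((Real.cos (lam * 2 ^ n * x) : ℝ) : ℂ))) := by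
  have hφ : HasDerivAt φ (deriv φ x) x := φ.differentiableAt.hasDerivAt
  have hsin : HasDerivAt (fun y : ℝ => ((Real.sin (lam * 2 ^ n * y) : ℝ) : ℂ))
      ((Real.cos (lam * 2 ^ n * x) * (lam * 2 ^ n) : ℝ) : ℂ) x := by
    have := ((hasDerivAt_id x).const_mul (lam * 2 ^ n)).sin.ofReal_comp
    simpa using this
  have hu : HasDerivAt (u0n s lam φ n) _ x :=
    (hφ.const_mul (((2 : ℝ) ^ (-((n : ℝ) * s)) : ℝ) : ℂ)).mul hsin
  have hB : HasDerivAt (fun y => φ y * φ y) _ x := hφ.mul hφ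
  rw [hu.deriv, hB.deriv, fseq]
  push_cast
  ring

theorem FT_fseq_mul_deriv_u0n (s lam : ℝ) (φ B h : SchwartzMap ℝ ℂ) (n : ℕ)
    (hB : ∀ x, B x = φ x * φ x) (hh : ∀ ξ, FT B ξ = h ξ)
    (hd : ∀ ξ, FT (deriv B) ξ = I * ξ * h ξ) (ξ : ℝ) :
    FT (fun x => fseq φ n x * deriv (u0n s lam φ n) x) ξ =
      (((2 : ℝ) ^ (-((n : ℝ) * s)) * (2 : ℝ) ^ (-(n : ℝ)) : ℝ) : ℂ) / 4 *
        (((ξ + lam * 2 ^ n : ℝ) : ℂ) * h (ξ - lam * 2 ^ n) -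
          ((ξ - lam * 2 ^ n : ℝ) : ℂ) * h (ξ + lam * 2 ^ n)) := by
  simp only [fseq_mul_deriv_u0n, ← hB]
  set c : ℂ := (((2 : ℝ) ^ (-((n : ℝ) * s)) * (2 : ℝ) ^ (-(n : ℝ)) : ℝ) : ℂ)
  set N : ℝ := lam * 2 ^ n
  have hBi : Integrable B := B.integrable
  have hdi : Integrable (deriv B) := (SchwartzMap.derivCLM ℂ ℂ B).integrable
  have hsi : Integrable fun x : ℝ => deriv B x * ((Real.sin (N * x) : ℝ) : ℂ) := by
    refine hdi.mul_bdd (c := 1) (by fun_prop) (Eventually.of_forall fun x => ?_)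
    rw [Complex.norm_real]
    exact Real.abs_sin_le_one _
  have hci : Integrable fun x : ℝ => B x * ((Real.cos (N * x) : ℝ) : ℂ) := by
    refine hBi.mul_bdd (c := 1) (by fun_prop) (Eventually.of_forall fun x => ?_)
    rw [Complex.norm_real]
    exact Real.abs_cos_le_one _
  have key : FT (fun x => c * (deriv B x / 2 * ((Real.sin (N * x) : ℝ) : ℂ) +
      (N : ℂ) * (B x * ((Real.cos (N * x) : ℝ) : ℂ)))) ξ =
      c * (FT (fun x => deriv B x * ((Real.sin (N * x) : ℝ) : ℂ)) ξ / 2 +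
        N * FT (fun x => B x * ((Real.cos (N * x) : ℝ) : ℂ)) ξ) := by
    unfold FT
    rw [← integral_div, ← integral_const_mul, ← integral_add
      ((integrable_exp_mul hsi ξ).div_const 2) ((integrable_exp_mul hci ξ).const_mul _),
      ← integral_const_mul]
    congr 1 with x
    ring
  rw [key, FT_mul_sin hdi, FT_mul_cos hBi, hd, hd, hh, hh]
  push_cast
  field_simp
  ring

/-- A Peetre-type inequality for the weight of the high-frequency part. -/
theorem weight_mul_sq_le {s K N ξ : ℝ} (hs : 0 ≤ s) (hK : 1 ≤ K) (hN : |N| ≤ 3 / 2 * K) :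
    (1 + ξ ^ 2) ^ s * (ξ + N) ^ 2 ≤
      18 * 8 ^ s * ((K ^ 2) ^ s * K ^ 2) * (1 + (ξ - N) ^ 2) ^ (s + 1) := by
  have hN2 : N ^ 2 ≤ 9 / 4 * K ^ 2 := by
    have := sq_le_sq' (by linarith [abs_nonneg N]) hN
    rw [sq_abs] at this
    linarith
  have hK2 : 1 ≤ K ^ 2 := by nlinarith
  set η := ξ - N
  have hξ : ξ = η + N := by simp [η]
  have hη : η ^ 2 ≤ K ^ 2 * η ^ 2 := by nlinarith [sq_nonneg η]
  have h1 : 1 + ξ ^ 2 ≤ 8 * K ^ 2 * (1 + η ^ 2) := by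
    rw [hξ]; nlinarith [sq_nonneg (η - N)]
  have h2 : (ξ + N) ^ 2 ≤ 18 * K ^ 2 * (1 + η ^ 2) := by
    rw [hξ]; nlinarith [sq_nonneg (η - 2 * N)]
  have h3 : (1 + ξ ^ 2) ^ s ≤ 8 ^ s * (K ^ 2) ^ s * (1 + η ^ 2) ^ s := by
    rw [← Real.mul_rpow (by positivity) (by positivity),
      ← Real.mul_rpow (by positivity) (by positivity)]
    exact Real.rpow_le_rpow (by positivity) h1 hs
  rw [Real.rpow_add_one (by positivity)]
  calc _ ≤ (8 ^ s * (K ^ 2) ^ s * (1 + η ^ 2) ^ s) * (18 * K ^ 2 * (1 + η ^ 2)) := by gcongr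
    _ = _ := by ring

theorem integrable_weight_schwartz (r : ℝ) (h : SchwartzMap ℝ ℂ) :
    Integrable fun η : ℝ => (1 + η ^ 2) ^ r * ‖h η‖ ^ 2 := by
  have hg := Function.hasTemperateGrowth_one_add_norm_sq_rpow ℝ r
  refine ((SchwartzMap.pairing (ContinuousLinearMap.mul ℝ ℂ)
    (SchwartzMap.smulLeftCLM ℂ (fun x : ℝ => (1 + ‖x‖ ^ 2) ^ r) h) h).integrable
      (μ := volume)).norm.congr (Eventually.of_forall fun x => ?_)
  have : 0 ≤ (1 + x ^ 2) ^ r := by positivity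
  beta_reduce
  rw [SchwartzMap.pairing_apply_apply, SchwartzMap.smulLeftCLM_apply_apply hg,
    ContinuousLinearMap.mul_apply', norm_mul, norm_smul, Real.norm_eq_abs, Real.norm_eq_abs,
    sq_abs, abs_of_nonneg this]
  ring

/-- The normalising factor `2^{-ns} 2^{-n}` compensates the weight at frequency `2ⁿ`. -/
theorem sq_coeff_mul (s : ℝ) (n : ℕ) :
    ((2 : ℝ) ^ (-((n : ℝ) * s)) * (2 : ℝ) ^ (-(n : ℝ))) ^ 2 *
      ((((2 : ℝ) ^ n) ^ 2) ^ s * ((2 : ℝ) ^ n) ^ 2) = 1 := by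
  have h1 : (((2 : ℝ) ^ n) ^ 2) ^ s = ((2 : ℝ) ^ ((n : ℝ) * s)) ^ 2 := by
    rw [Real.rpow_mul (by norm_num), Real.rpow_natCast, Real.rpow_pow_comm (by positivity)]
  rw [h1, Real.rpow_neg (by norm_num), Real.rpow_neg (by norm_num), Real.rpow_natCast]
  have : (2 : ℝ) ^ ((n : ℝ) * s) ≠ 0 := by positivity
  field_simp

theorem weight_mul_norm_sq_le {s K N c : ℝ} (h : ℝ → ℂ) (hs : 0 ≤ s) (hK : 1 ≤ K)
    (hN : |N| ≤ 3 / 2 * K) (hc : c ^ 2 * ((K ^ 2) ^ s * K ^ 2) = 1) (ξ : ℝ) :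
    (1 + ξ ^ 2) ^ s *
        ‖(c : ℂ) / 4 * (((ξ + N : ℝ) : ℂ) * h (ξ - N) - ((ξ - N : ℝ) : ℂ) * h (ξ + N))‖ ^ 2 ≤
      18 * 8 ^ s / 8 * ((1 + (ξ - N) ^ 2) ^ (s + 1) * ‖h (ξ - N)‖ ^ 2 +
        (1 + (ξ + N) ^ 2) ^ (s + 1) * ‖h (ξ + N)‖ ^ 2) := by
  have h1 := weight_mul_sq_le (ξ := ξ) hs hK hN
  have h2 := weight_mul_sq_le (N := -N) (ξ := ξ) hs hK (by rwa [abs_neg])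
  rw [sub_neg_eq_add, ← sub_eq_add_neg] at h2
  have h3 : ‖((ξ + N : ℝ) : ℂ) * h (ξ - N) - ((ξ - N : ℝ) : ℂ) * h (ξ + N)‖ ^ 2 ≤
      2 * ((ξ + N) ^ 2 * ‖h (ξ - N)‖ ^ 2 + (ξ - N) ^ 2 * ‖h (ξ + N)‖ ^ 2) := by
    have := norm_sub_le (((ξ + N : ℝ) : ℂ) * h (ξ - N)) (((ξ - N : ℝ) : ℂ) * h (ξ + N))
    rw [norm_mul, norm_mul, Complex.norm_real, Complex.norm_real, Real.norm_eq_abs,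
      Real.norm_eq_abs] at this
    calc _ ≤ (|ξ + N| * ‖h (ξ - N)‖ + |ξ - N| * ‖h (ξ + N)‖) ^ 2 := by gcongr
      _ ≤ 2 * ((|ξ + N| * ‖h (ξ - N)‖) ^ 2 + (|ξ - N| * ‖h (ξ + N)‖) ^ 2) := add_sq_le
      _ = _ := by rw [mul_pow, mul_pow, sq_abs, sq_abs]
  rw [norm_mul, mul_pow, norm_div, Complex.norm_real, Real.norm_eq_abs, div_pow, sq_abs]
  norm_num only [Complex.norm_ofNat]
  have hw : 0 ≤ (1 + ξ ^ 2) ^ s := by positivity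
  calc _ ≤ (1 + ξ ^ 2) ^ s * (c ^ 2 / 16 *
        (2 * ((ξ + N) ^ 2 * ‖h (ξ - N)‖ ^ 2 + (ξ - N) ^ 2 * ‖h (ξ + N)‖ ^ 2))) := by gcongr
    _ = c ^ 2 / 8 * ((1 + ξ ^ 2) ^ s * (ξ + N) ^ 2 * ‖h (ξ - N)‖ ^ 2 +
        (1 + ξ ^ 2) ^ s * (ξ - N) ^ 2 * ‖h (ξ + N)‖ ^ 2) := by ring
    _ ≤ c ^ 2 / 8 * (18 * 8 ^ s * ((K ^ 2) ^ s * K ^ 2) * (1 + (ξ - N) ^ 2) ^ (s + 1) *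
          ‖h (ξ - N)‖ ^ 2 +
        18 * 8 ^ s * ((K ^ 2) ^ s * K ^ 2) * (1 + (ξ + N) ^ 2) ^ (s + 1) *
          ‖h (ξ + N)‖ ^ 2) := by gcongr
    _ = c ^ 2 * ((K ^ 2) ^ s * K ^ 2) * (18 * 8 ^ s / 8 *
        ((1 + (ξ - N) ^ 2) ^ (s + 1) * ‖h (ξ - N)‖ ^ 2 +
          (1 + (ξ + N) ^ 2) ^ (s + 1) * ‖h (ξ + N)‖ ^ 2)) := by ring
    _ = _ := by rw [hc, one_mul]

theorem le_weight_mul_norm_sq {s K N c R M a ξ : ℝ} (h : ℝ → ℂ) (hs : 0 ≤ s) (hK : 1 ≤ K)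
    (hN : K ≤ N) (hc : c ^ 2 * ((K ^ 2) ^ s * K ^ 2) = 1) (ha : 0 < a)
    (hM : ‖h (ξ + N)‖ ≤ M) (hξ : |ξ - N| ≤ R) (hah : a ≤ ‖h (ξ - N)‖) (hKR : 2 * R ≤ K)
    (hKM : 2 * (R * M) ≤ a * K) :
    (1 / 4) ^ s * a ^ 2 / 64 ≤ (1 + ξ ^ 2) ^ s *
      ‖(c : ℂ) / 4 * (((ξ + N : ℝ) : ℂ) * h (ξ - N) - ((ξ - N : ℝ) : ℂ) * h (ξ + N))‖ ^ 2 := by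
  obtain ⟨hl, hr⟩ := abs_le.mp hξ
  have hR : 0 ≤ R := (abs_nonneg _).trans hξ
  have h1 : a * K / 2 ≤
      ‖((ξ + N : ℝ) : ℂ) * h (ξ - N) - ((ξ - N : ℝ) : ℂ) * h (ξ + N)‖ := by
    have := norm_sub_norm_le (((ξ + N : ℝ) : ℂ) * h (ξ - N)) (((ξ - N : ℝ) : ℂ) * h (ξ + N))
    rw [norm_mul, norm_mul, Complex.norm_real, Complex.norm_real, Real.norm_eq_abs,
      Real.norm_eq_abs, abs_of_nonneg (show 0 ≤ ξ + N by linarith)] at this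
    have h2 : K * a ≤ (ξ + N) * ‖h (ξ - N)‖ :=
      mul_le_mul (by linarith) hah ha.le (by linarith)
    have h3 : |ξ - N| * ‖h (ξ + N)‖ ≤ R * M := mul_le_mul hξ hM (norm_nonneg _) hR
    linarith
  have h2 : (1 / 4) ^ s * (K ^ 2) ^ s ≤ (1 + ξ ^ 2) ^ s := by
    rw [← Real.mul_rpow (by positivity) (by positivity)]
    refine Real.rpow_le_rpow (by positivity) ?_ hs
    nlinarith
  rw [norm_mul, mul_pow, norm_div, Complex.norm_real, Real.norm_eq_abs, div_pow, sq_abs]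
  norm_num only [Complex.norm_ofNat]
  calc (1 / 4) ^ s * a ^ 2 / 64 =
        c ^ 2 * ((K ^ 2) ^ s * K ^ 2) * ((1 / 4) ^ s * a ^ 2 / 64) := by rw [hc, one_mul]
    _ = (1 / 4) ^ s * (K ^ 2) ^ s * (c ^ 2 / 16 * (a * K / 2) ^ 2) := by ring
    _ ≤ _ := by gcongr

/-- `liminf_{n→∞} ‖f_n ∂ₓu_{0,n}‖_{H^s} ≥ C̃₁ > 0`. -/
theorem stmt6 (s lam : ℝ) (hs : 3 / 2 < s) (hlam : lam ∈ Set.Ioo (4 / 3 : ℝ) (3 / 2))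
    (φ : SchwartzMap ℝ ℂ) (hφ : PhiHyp ⇑φ) :
    ∃ C1 > (0 : ℝ),
      C1 ≤ Filter.liminf
        (fun n : ℕ => HNorm s (fun x => fseq ⇑φ n x * deriv (u0n s lam ⇑φ n) x))
        Filter.atTop := by
  obtain ⟨ψ, hψ, -, -, -, hψ1, -⟩ := hφ
  have hφ0 : φ ≠ 0 := by
    rintro rfl
    have := hψ 0
    rw [hψ1 0 (by norm_num)] at this
    simp [FT] at this
  let B : SchwartzMap ℝ ℂ := SchwartzMap.pairing (ContinuousLinearMap.mul ℝ ℂ) φ φ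
  have hB : ∀ x, B x = φ x * φ x := fun x => by
    simp [B, SchwartzMap.pairing_apply_apply]
  have hB0 : B ≠ 0 := fun H => hφ0 <| by
    ext x
    have := hB x
    rw [H] at this
    simpa using this
  obtain ⟨h, hh, hd, η, hη⟩ := exists_schwartz_FT B hB0
  have hs0 : 0 ≤ s := by linarith
  let G : ℕ → ℝ → ℝ := fun n ξ =>
    (1 + ξ ^ 2) ^ s * ‖FT (fun x => fseq φ n x * deriv (u0n s lam φ n) x) ξ‖ ^ 2
  have hGdef : ∀ n, HNorm s (fun x => fseq φ n x * deriv (u0n s lam φ n) x) =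
    Real.sqrt (∫ ξ, G n ξ) := fun n => rfl
  have hG0 : ∀ n ξ, 0 ≤ G n ξ := fun n ξ => by positivity
  have hK : ∀ n : ℕ, (1 : ℝ) ≤ 2 ^ n := fun n => one_le_pow₀ (by norm_num)
  have hN1 : ∀ n : ℕ, (2 : ℝ) ^ n ≤ lam * 2 ^ n := fun n => by
    nlinarith [hK n, hlam.1]
  have hN2 : ∀ n : ℕ, |lam * 2 ^ n| ≤ 3 / 2 * 2 ^ n := fun n => by
    rw [abs_of_nonneg (by linarith [hK n, hN1 n])]
    nlinarith [hK n, hlam.2]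
  let w : ℝ → ℝ := fun ξ => (1 + ξ ^ 2) ^ (s + 1) * ‖h ξ‖ ^ 2
  have hw : Integrable w := integrable_weight_schwartz (s + 1) h
  have hGle : ∀ n ξ, G n ξ ≤
      18 * 8 ^ s / 8 * (w (ξ - lam * 2 ^ n) + w (ξ + lam * 2 ^ n)) := fun n ξ => by
    simp only [G, FT_fseq_mul_deriv_u0n s lam φ B h n hB hh hd]
    exact weight_mul_norm_sq_le h hs0 (hK n) (hN2 n) (sq_coeff_mul s n) ξ
  have hwi : ∀ n : ℕ, Integrable fun ξ =>
      18 * 8 ^ s / 8 * (w (ξ - lam * 2 ^ n) + w (ξ + lam * 2 ^ n)) := fun n =>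
    ((hw.comp_sub_right _).add (hw.comp_add_right _)).const_mul _
  have hGi : ∀ n, Integrable (G n) := fun n => by
    refine (hwi n).mono' ?_ (Eventually.of_forall fun ξ => ?_)
    · simp only [G, FT_fseq_mul_deriv_u0n s lam φ B h n hB hh hd]
      have := h.continuous
      exact Measurable.aestronglyMeasurable (by fun_prop)
    · rw [Real.norm_of_nonneg (hG0 n ξ)]
      exact hGle n ξ
  have hupper : ∀ n, ∫ ξ, G n ξ ≤ 18 * 8 ^ s / 8 * ((∫ ξ, w ξ) + ∫ ξ, w ξ) := fun n => by
    refine (integral_mono (hGi n) (hwi n) (hGle n)).trans_eq ?_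
    rw [integral_const_mul, integral_add (hw.comp_sub_right _) (hw.comp_add_right _),
      integral_sub_right_eq_self w, integral_add_right_eq_self w]
  obtain ⟨M, hM⟩ : ∃ M, ∀ x, ‖h x‖ ≤ M := by
    obtain ⟨M, hM⟩ := h.decay 0 0
    exact ⟨M, fun x => by simpa using hM.2 x⟩
  set a := ‖h η‖ / 2 with ha
  have ha0 : 0 < a := by positivity
  obtain ⟨δ, hδ, hball⟩ : ∃ δ > 0, ∀ x ∈ Metric.ball η δ, a < ‖h x‖ :=
    Metric.eventually_nhds_iff_ball.mp
      (h.continuous.norm.continuousAt.eventually_const_lt (by simp only [ha]; linarith))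
  set m := (1 / 4 : ℝ) ^ s * a ^ 2 / 64
  have hlower : ∀ᶠ n : ℕ in atTop, m * (2 * δ) ≤ ∫ ξ, G n ξ := by
    have htop : Tendsto (fun n : ℕ => (2 : ℝ) ^ n) atTop atTop :=
      tendsto_pow_atTop_atTop_of_one_lt (by norm_num)
    filter_upwards [htop.eventually_ge_atTop (2 * (|η| + δ)),
      (htop.const_mul_atTop ha0).eventually_ge_atTop (2 * ((|η| + δ) * M))] with n hn1 hn2
    refine le_trans ?_ (setIntegral_le_integral (s := Metric.ball (η + lam * 2 ^ n) δ) (hGi n)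
      (Eventually.of_forall (hG0 n)))
    have hvol : volume.real (Metric.ball (η + lam * 2 ^ n) δ) = 2 * δ := by
      rw [Real.volume_real_ball hδ.le]
    rw [← hvol]
    refine setIntegral_ge_of_const_le_real measurableSet_ball measure_ball_lt_top.ne
      (fun ξ hξ => ?_) (hGi n).integrableOn
    rw [Metric.mem_ball, Real.dist_eq] at hξ
    have hξ' : |ξ - lam * 2 ^ n - η| < δ := by
      convert hξ using 2
      ring
    simp only [G, FT_fseq_mul_deriv_u0n s lam φ B h n hB hh hd]
    refine le_weight_mul_norm_sq h hs0 (hK n) (hN1 n) (sq_coeff_mul s n) ha0 (hM _)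
      (R := |η| + δ) ?_ (hball _ (by rwa [Metric.mem_ball, Real.dist_eq])).le hn1 hn2
    have := abs_add_le (ξ - lam * 2 ^ n - η) η
    rw [sub_add_cancel] at this
    linarith
  refine ⟨Real.sqrt (m * (2 * δ)), Real.sqrt_pos.mpr (by positivity), ?_⟩
  refine le_liminf_of_le ?_ ?_
  · refine IsBoundedUnder.isCoboundedUnder_ge
      ⟨Real.sqrt (18 * 8 ^ s / 8 * ((∫ ξ, w ξ) + ∫ ξ, w ξ)), ?_⟩
    rw [eventually_map]
    exact Eventually.of_forall fun n => (hGdef n).trans_le (Real.sqrt_le_sqrt (hupper n))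
  · filter_upwards [hlower] with n hn
    exact (Real.sqrt_le_sqrt hn).trans_eq (hGdef n).symm
end
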